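/- arXiv:2501.19170 — 3 statements merged into one kernel-verified Lean document; each statement's English description precedes it below -/
import Mathlib

section
/- Let T > 0, let V_p, V_f, Λ be real Banach spaces, let M^p and A^p be continuous symmetric bilinear forms on V_p, let D^p be a continuous bilinear form on V_p, let M^f and D^f be continuous bilinear forms on V_f, let A^f be a continuous symmetric bilinear form on V_f, let B^f : Λ × V_f → ℝ and C : V_p × V_f → ℝ be continuous bilinear forms, and let F : [0,T] → (V_p × V_f)' be continuous. Suppose u : [0,T] → V_p is twice continuously differentiable, Σ : [0,T] → V_f is continuously differentiable, r : [0,T] → Λ is continuous, and for all t ∈ [0,T] and all (v, τ, λ) ∈ V_p × V_f × Λ: M^p(u''(t), v) + M^f(Σ'(t), τ) + D^p(u'(t), v) + D^f(Σ'(t), τ) + A^p(u(t), v) + A^f(Σ(t), τ) + B^f(r(t), τ) - B^f(λ, Σ'(t)) + C(u'(t), τ) - C(v, Σ'(t)) = F(t)(v, τ). Then for every t ∈ [0,T]: ½M^p(u'(t), u'(t)) + ½A^p(u(t), u(t)) + ½A^f(Σ(t), Σ(t)) + ∫₀ᵗ [M^f(Σ'(s), Σ'(s)) + D^p(u'(s),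 u'(s)) + D^f(Σ'(s), Σ'(s))] ds = ½M^p(u'(0), u'(0)) + ½A^p(u(0), u(0)) + ½A^f(Σ(0), Σ(0)) + ∫₀ᵗ F(s)(u'(s), Σ'(s)) ds. -/
/-- The quadratic form `½ B(x, x)` of a symmetric bounded bilinear form has derivative
`B(x, x')` along a differentiable curve. -/
theorem HasDerivWithinAt.half_symm_bilin {E : Type*} [NormedAddCommGroup E] [NormedSpace ℝ E]
    (B : E →L[ℝ] E →L[ℝ] ℝ) (hB : ∀ x y : E, B x y = B y x) {x : ℝ → E} {x' : E}
    {s : Set ℝ} {t : ℝ} (hx : HasDerivWithinAt x x' s t) :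
    HasDerivWithinAt (fun t => (1/2) * B (x t) (x t)) (B (x t) x') s t := by
  have h := ((B.hasFDerivAt.comp_hasDerivWithinAt t hx).clm_apply hx).const_mul (1/2 : ℝ)
  refine h.congr_deriv ?_
  simp only [Function.comp_apply]
  rw [hB x' (x t)]
  ring

/-- Coupled energy identity for the abstract Stokes–Biot weak formulation: testing the
variational equation with `(u', Σ', r)` makes the coupling and weak-symmetry terms cancel
and yields the energy balance. -/
theorem coupled_stokes_biot_energy_identity
    (Vp Vf Lam : Type*)
    [NormedAddCommGroup Vp] [NormedSpace ℝ Vp] [CompleteSpace Vp]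
    [NormedAddCommGroup Vf] [NormedSpace ℝ Vf] [CompleteSpace Vf]
    [NormedAddCommGroup Lam] [NormedSpace ℝ Lam] [CompleteSpace Lam]
    (Mp Ap Dp : Vp →L[ℝ] Vp →L[ℝ] ℝ)
    (hMp : ∀ x y : Vp, Mp x y = Mp y x) (hAp : ∀ x y : Vp, Ap x y = Ap y x)
    (Mf Df Af : Vf →L[ℝ] Vf →L[ℝ] ℝ)
    (hAf : ∀ x y : Vf, Af x y = Af y x)
    (Bf : Lam →L[ℝ] Vf →L[ℝ] ℝ) (C : Vp →L[ℝ] Vf →L[ℝ] ℝ)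
    (T : ℝ) (hT : 0 < T)
    (F : ℝ → (Vp × Vf) →L[ℝ] ℝ) (hF : ContinuousOn F (Set.Icc 0 T))
    (u u' u'' : ℝ → Vp)
    (hu : ∀ t ∈ Set.Icc (0:ℝ) T, HasDerivWithinAt u (u' t) (Set.Icc 0 T) t)
    (hu' : ∀ t ∈ Set.Icc (0:ℝ) T, HasDerivWithinAt u' (u'' t) (Set.Icc 0 T) t)
    (hu'' : ContinuousOn u'' (Set.Icc 0 T))
    (S S' : ℝ → Vf)
    (hS : ∀ t ∈ Set.Icc (0:ℝ) T, HasDerivWithinAt S (S' t) (Set.Icc 0 T) t)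
    (hS' : ContinuousOn S' (Set.Icc 0 T))
    (r : ℝ → Lam) (hr : ContinuousOn r (Set.Icc 0 T))
    (heq : ∀ t ∈ Set.Icc (0:ℝ) T, ∀ v : Vp, ∀ τ : Vf, ∀ l : Lam,
      Mp (u'' t) v + Mf (S' t) τ + Dp (u' t) v + Df (S' t) τ +
          Ap (u t) v + Af (S t) τ + Bf (r t) τ - Bf l (S' t) +
          C (u' t) τ - C v (S' t) = F t (v, τ)) :
    ∀ t ∈ Set.Icc (0:ℝ) T,
      (1/2) * Mp (u' t) (u' t) + (1/2) * Ap (u t) (u t) + (1/2) * Af (S t) (S t)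
          + ∫ s in (0:ℝ)..t, (Mf (S' s) (S' s) + Dp (u' s) (u' s) + Df (S' s) (S' s))
        = (1/2) * Mp (u' 0) (u' 0) + (1/2) * Ap (u 0) (u 0) + (1/2) * Af (S 0) (S 0)
          + ∫ s in (0:ℝ)..t, F s (u' s, S' s) := by
  intro t ht
  have hsub : Set.Icc (0:ℝ) t ⊆ Set.Icc 0 T := Set.Icc_subset_Icc_right ht.2
  have hcu' : ContinuousOn u' (Set.Icc 0 t) :=
    fun s hs => ((hu' s (hsub hs)).continuousWithinAt).mono hsub
  have hcS' := hS'.mono hsub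
  have hcF := hF.mono hsub
  have hdiss : IntervalIntegrable
      (fun s => Mf (S' s) (S' s) + Dp (u' s) (u' s) + Df (S' s) (S' s)) MeasureTheory.volume 0 t := by
    apply ContinuousOn.intervalIntegrable_of_Icc ht.1
    exact (((Mf.continuous.comp_continuousOn hcS').clm_apply hcS').add
      ((Dp.continuous.comp_continuousOn hcu').clm_apply hcu')).add
      ((Df.continuous.comp_continuousOn hcS').clm_apply hcS')
  have hwork : IntervalIntegrable (fun s => F s (u' s, S' s)) MeasureTheory.volume 0 t :=
    (hcF.clm_apply (hcu'.prodMk hcS')).intervalIntegrable_of_Icc ht.1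
  have hderiv : ∀ s ∈ Set.Icc (0:ℝ) T, HasDerivWithinAt
      (fun s => (1/2) * Mp (u' s) (u' s) + (1/2) * Ap (u s) (u s) + (1/2) * Af (S s) (S s))
      (F s (u' s, S' s) - (Mf (S' s) (S' s) + Dp (u' s) (u' s) + Df (S' s) (S' s)))
      (Set.Icc 0 T) s := by
    intro s hs
    refine ((((hu' s hs).half_symm_bilin Mp hMp).add ((hu s hs).half_symm_bilin Ap hAp)).add
      ((hS s hs).half_symm_bilin Af hAf)).congr_deriv ?_
    rw [← heq s hs (u' s) (S' s) (r s), hMp (u' s) (u'' s)]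
    ring
  have hftc := intervalIntegral.integral_eq_sub_of_hasDerivAt_of_le ht.1
    (fun s hs => ((hderiv s (hsub hs)).continuousWithinAt).mono hsub)
    (fun s hs => (hderiv s (hsub (Set.Ioo_subset_Icc_self hs))).hasDerivAt
      (Icc_mem_nhds hs.1 (hs.2.trans_le ht.2))) (hwork.sub hdiss)
  rw [intervalIntegral.integral_sub hwork hdiss] at hftc
  linarith
end

section
/- Let T > 0, let V_p, V_f, Λ be real Banach spaces, let M^p, A^p be continuous symmetric positive-semidefinite bilinear forms and D^p a continuous symmetric positive-semidefinite bilinear form on V_p, let M^f, D^f, A^f be continuous symmetric positive-semidefinite bilinear forms on V_f, let B^f : Λ × V_f → ℝ and C : V_p × V_f → ℝ be continuous bilinear forms. Let g, h, ĥ : [0,T] → ℝ be continuous and nonnegative, let F_p : [0,T] → V_p' be continuous with |F_p(t)(v)| ≤ g(t)·√(M^p(v,v)) for all t and v, and let F_f : [0,T] → V_f' be continuously differentiable with |F_f(t)(τ)| ≤ h(t)·√(A^f(τ,τ) + M^f(τ,τ) + D^f(τ,τ)) and |F_f'(t)(τ)| ≤ ĥ(t)·√(A^f(τ,τ) + M^f(τ,τ)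 + D^f(τ,τ)) for all t and τ. Suppose u : [0,T] → V_p is twice continuously differentiable, Σ : [0,T] → V_f is continuously differentiable with Σ(0) = 0, r : [0,T] → Λ is continuous, and for all t ∈ [0,T] and all (v, τ, λ) ∈ V_p × V_f × Λ: M^p(u''(t), v) + M^f(Σ'(t), τ) + D^p(u'(t), v) + D^f(Σ'(t), τ) + A^p(u(t), v) + A^f(Σ(t), τ) + B^f(r(t), τ) - B^f(λ, Σ'(t)) + C(u'(t), τ) - C(v, Σ'(t)) = F_p(t)(v) + F_f(t)(τ). Then there exists a constant K > 0, depending only on T, such that for all t ∈ [0,T]: √(M^p(u'(t),u'(t)) + A^p(u(t),u(t)) + A^f(Σ(t),Σ(t)) + M^f(Σ(t),Σ(t)) + D^f(Σ(t),Σ(t))) ≤ K·( √(M^p(u'(0),u'(0)) + A^p(u(0),u(0))) + sup_{s∈[0,T]} h(s) + ∫₀ᵀ (g(s) + ĥ(s)) ds ). -/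
open Set MeasureTheory

/-- The derivative of a symmetric continuous quadratic form along a curve. -/
lemma hasDerivAt_symm_quadratic {E : Type*} [NormedAddCommGroup E] [NormedSpace ℝ E]
    (B : E →L[ℝ] E →L[ℝ] ℝ) (hB : ∀ x y, B x y = B y x) {f : ℝ → E} {f' : E} {s : ℝ}
    (hf : HasDerivAt f f' s) : HasDerivAt (fun x ↦ B (f x) (f x)) (2 * B f' (f s)) s := by
  refine ((B.hasFDerivAt.comp_hasDerivAt s hf).clm_apply hf).congr_deriv ?_
  simp only [Function.comp_apply, hB (f s) f']
  ring

/-- Completing the square for a positive semidefinite symmetric bilinear form. -/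
lemma two_mul_apply_sub_sq_le {E : Type*} [NormedAddCommGroup E] [NormedSpace ℝ E]
    (B : E →L[ℝ] E →L[ℝ] ℝ) (hB : ∀ x y, B x y = B y x) (hB0 : ∀ x, 0 ≤ B x x)
    (x y : E) (c : ℝ) : 2 * c * B x y - c ^ 2 * B y y ≤ B x x := by
  have h := hB0 (x - c • y)
  simp only [map_sub, map_smul, sub_apply, FunLike.coe_smul, Pi.smul_apply,
    smul_eq_mul, hB y x] at h
  linarith

/-- The derivative of the primitive of a function continuous on a compact interval,
at an interior point. -/
lemma hasDerivAt_integral_of_continuousOn_Icc {G : ℝ → ℝ} {a b s : ℝ}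
    (hG : ContinuousOn G (Icc a b)) (hs : s ∈ Ioo a b) :
    HasDerivAt (fun x ↦ ∫ y in a..x, G y) (G s) s := by
  refine intervalIntegral.integral_hasDerivAt_right ?_ ?_ ?_
  · refine ContinuousOn.intervalIntegrable (hG.mono ?_)
    rw [uIcc_of_le hs.1.le]
    exact Icc_subset_Icc_right hs.2.le
  · exact (hG.mono Ioo_subset_Icc_self).stronglyMeasurableAtFilter isOpen_Ioo s hs
  · exact hG.continuousAt (Icc_mem_nhds hs.1 hs.2)

/-- The quadratic inequality behind the energy estimate. -/
lemma le_max_mul_of_energy_inequality {T m e N H J P : ℝ} (hT : 0 < T) (hm : 0 ≤ m) (he : 0 ≤ e)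
    (hem : e ≤ m) (hN : 0 ≤ N) (hH : 0 ≤ H) (hJ : 0 ≤ J) (hmP : m ^ 2 = P + N)
    (hP : 0 ≤ P) (h : P / 2 + N / T ≤ e ^ 2 / 2 + H * m + J * m) :
    m ≤ max 2 T * (e + H + J) := by
  have hK2 : 2 ≤ max 2 T := le_max_left _ _
  have hKT : T ≤ max 2 T := le_max_right _ _
  have hP' : P ≤ max 2 T * (P / 2) := by nlinarith
  have hN' : N ≤ max 2 T * (N / T) := by
    calc N = T * (N / T) := by field_simp
      _ ≤ _ := by gcongr
  have hsq : m ^ 2 ≤ (max 2 T * (e + H + J)) * m := by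
    calc m ^ 2 ≤ max 2 T * (P / 2 + N / T) := by linarith
      _ ≤ max 2 T * (e ^ 2 / 2 + H * m + J * m) := by gcongr
      _ ≤ max 2 T * ((e + H + J) * m) := by gcongr; nlinarith
      _ = _ := by ring
  rcases hm.eq_or_lt with h0 | h0
  · rw [← h0]; positivity
  · nlinarith


/-- Abstract stability estimate (Theorem 2.3) for the coupled Stokes–Biot weak
formulation: the energy norm of the solution is bounded, with a constant depending
only on `T`, by the initial energy and the data terms. -/
theorem coupled_stokes_biot_stability (T : ℝ) (hT : 0 < T) :
    ∃ K : ℝ, 0 < K ∧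
      ∀ (Vp Vf Lam : Type*)
        [NormedAddCommGroup Vp] [NormedSpace ℝ Vp] [CompleteSpace Vp]
        [NormedAddCommGroup Vf] [NormedSpace ℝ Vf] [CompleteSpace Vf]
        [NormedAddCommGroup Lam] [NormedSpace ℝ Lam] [CompleteSpace Lam]
        (Mp Ap Dp : Vp →L[ℝ] Vp →L[ℝ] ℝ)
        (_hMp_symm : ∀ x y : Vp, Mp x y = Mp y x) (_hMp_psd : ∀ x : Vp, 0 ≤ Mp x x)
        (_hAp_symm : ∀ x y : Vp, Ap x y = Ap y x) (_hAp_psd : ∀ x : Vp, 0 ≤ Ap x x)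
        (_hDp_symm : ∀ x y : Vp, Dp x y = Dp y x) (_hDp_psd : ∀ x : Vp, 0 ≤ Dp x x)
        (Mf Df Af : Vf →L[ℝ] Vf →L[ℝ] ℝ)
        (_hMf_symm : ∀ x y : Vf, Mf x y = Mf y x) (_hMf_psd : ∀ x : Vf, 0 ≤ Mf x x)
        (_hDf_symm : ∀ x y : Vf, Df x y = Df y x) (_hDf_psd : ∀ x : Vf, 0 ≤ Df x x)
        (_hAf_symm : ∀ x y : Vf, Af x y = Af y x) (_hAf_psd : ∀ x : Vf, 0 ≤ Af x x)
        (Bf : Lam →L[ℝ] Vf →L[ℝ] ℝ) (C : Vp →L[ℝ] Vf →L[ℝ] ℝ)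
        (g h h' : ℝ → ℝ)
        (_hg_cont : ContinuousOn g (Set.Icc 0 T)) (_hg_nonneg : ∀ t ∈ Set.Icc (0:ℝ) T, 0 ≤ g t)
        (_hh_cont : ContinuousOn h (Set.Icc 0 T)) (_hh_nonneg : ∀ t ∈ Set.Icc (0:ℝ) T, 0 ≤ h t)
        (_hh'_cont : ContinuousOn h' (Set.Icc 0 T)) (_hh'_nonneg : ∀ t ∈ Set.Icc (0:ℝ) T, 0 ≤ h' t)
        (Fp : ℝ → Vp →L[ℝ] ℝ) (_hFp_cont : ContinuousOn Fp (Set.Icc 0 T))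
        (_hFp_bound : ∀ t ∈ Set.Icc (0:ℝ) T, ∀ v : Vp,
          |Fp t v| ≤ g t * Real.sqrt (Mp v v))
        (Ff Ff' : ℝ → Vf →L[ℝ] ℝ)
        (_hFf_deriv : ∀ t ∈ Set.Icc (0:ℝ) T, HasDerivWithinAt Ff (Ff' t) (Set.Icc 0 T) t)
        (_hFf'_cont : ContinuousOn Ff' (Set.Icc 0 T))
        (_hFf_bound : ∀ t ∈ Set.Icc (0:ℝ) T, ∀ τ : Vf,
          |Ff t τ| ≤ h t * Real.sqrt (Af τ τ + Mf τ τ + Df τ τ))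
        (_hFf'_bound : ∀ t ∈ Set.Icc (0:ℝ) T, ∀ τ : Vf,
          |Ff' t τ| ≤ h' t * Real.sqrt (Af τ τ + Mf τ τ + Df τ τ))
        (u u' u'' : ℝ → Vp)
        (_hu : ∀ t ∈ Set.Icc (0:ℝ) T, HasDerivWithinAt u (u' t) (Set.Icc 0 T) t)
        (_hu' : ∀ t ∈ Set.Icc (0:ℝ) T, HasDerivWithinAt u' (u'' t) (Set.Icc 0 T) t)
        (_hu'' : ContinuousOn u'' (Set.Icc 0 T))
        (S S' : ℝ → Vf)
        (_hS : ∀ t ∈ Set.Icc (0:ℝ) T, HasDerivWithinAt S (S' t) (Set.Icc 0 T) t)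
        (_hS' : ContinuousOn S' (Set.Icc 0 T))
        (_hS0 : S 0 = 0)
        (r : ℝ → Lam) (_hr : ContinuousOn r (Set.Icc 0 T))
        (_heq : ∀ t ∈ Set.Icc (0:ℝ) T, ∀ v : Vp, ∀ τ : Vf, ∀ l : Lam,
          Mp (u'' t) v + Mf (S' t) τ + Dp (u' t) v + Df (S' t) τ +
            Ap (u t) v + Af (S t) τ + Bf (r t) τ - Bf l (S' t) +
            C (u' t) τ - C v (S' t) = Fp t v + Ff t τ),
        ∀ t ∈ Set.Icc (0:ℝ) T,
          Real.sqrt (Mp (u' t) (u' t) + Ap (u t) (u t) + Af (S t) (S t) +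
              Mf (S t) (S t) + Df (S t) (S t)) ≤
            K * (Real.sqrt (Mp (u' 0) (u' 0) + Ap (u 0) (u 0)) +
              sSup (h '' Set.Icc 0 T) + ∫ s in (0:ℝ)..T, (g s + h' s)) := by
  refine ⟨max 2 T, by positivity, ?_⟩
  intro Vp Vf Lam _ _ _ _ _ _ _ _ _ Mp Ap Dp hMp hMp0 hAp hAp0 hDp hDp0 Mf Df Af hMf hMf0
    hDf hDf0 hAf hAf0 Bf C g h h' hg hg0 hh hh0 hh' hh0' Fp hFp hFpb Ff Ff' hFf hFf' hFfb hFfb'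
    u u' u'' hu hu' hu'' S S' hS hS' hS0 r hr heq t ht
  have huc : ContinuousOn u (Icc 0 T) := fun s hs ↦ (hu s hs).continuousWithinAt
  have huc' : ContinuousOn u' (Icc 0 T) := fun s hs ↦ (hu' s hs).continuousWithinAt
  have hSc : ContinuousOn S (Icc 0 T) := fun s hs ↦ (hS s hs).continuousWithinAt
  have hFfc : ContinuousOn Ff (Icc 0 T) := fun s hs ↦ (hFf s hs).continuousWithinAt
  have hGc : ContinuousOn (fun s ↦ g s + h' s) (Icc 0 T) := hg.add hh'
  have hEc : ContinuousOn (fun s ↦ √(Mp (u' s) (u' s) + Ap (u s) (u s) + Af (S s) (S s) +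
      Mf (S s) (S s) + Df (S s) (S s))) (Icc 0 T) := by fun_prop
  obtain ⟨t₁, ht₁, hmax⟩ := isCompact_Icc.exists_isMaxOn ⟨t, ht⟩ hEc
  have hm0 := Real.sqrt_nonneg (Mp (u' t₁) (u' t₁) + Ap (u t₁) (u t₁) + Af (S t₁) (S t₁) +
      Mf (S t₁) (S t₁) + Df (S t₁) (S t₁))
  have hm2 := Real.sq_sqrt (show 0 ≤ Mp (u' t₁) (u' t₁) + Ap (u t₁) (u t₁) + Af (S t₁) (S t₁) +
      Mf (S t₁) (S t₁) + Df (S t₁) (S t₁) by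
    linarith [hMp0 (u' t₁), hAp0 (u t₁), hAf0 (S t₁), hMf0 (S t₁), hDf0 (S t₁)])
  simp only [isMaxOn_iff] at hmax
  refine (hmax t ht).trans ?_
  set m := √(Mp (u' t₁) (u' t₁) + Ap (u t₁) (u t₁) + Af (S t₁) (S t₁) +
      Mf (S t₁) (S t₁) + Df (S t₁) (S t₁))
  clear_value m
  have hJnn : ∀ s ∈ Icc 0 T, 0 ≤ g s + h' s := fun s hs ↦ add_nonneg (hg0 s hs) (hh0' s hs)
  have hJ0 : 0 ≤ ∫ s in (0:ℝ)..T, (g s + h' s) := intervalIntegral.integral_nonneg hT.le hJnn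
  have hGi : IntervalIntegrable (fun s ↦ g s + h' s) volume 0 T := by
    refine ContinuousOn.intervalIntegrable ?_
    rwa [uIcc_of_le hT.le]
  have hsup : h t₁ ≤ sSup (h '' Icc 0 T) :=
    le_csSup (isCompact_Icc.image_of_continuousOn hh).bddAbove (mem_image_of_mem h ht₁)
  have hfluid : ∀ s ∈ Icc 0 T, √(Af (S s) (S s) + Mf (S s) (S s) + Df (S s) (S s)) ≤ m :=
    fun s hs ↦ (Real.sqrt_le_sqrt (by linarith [hMp0 (u' s), hAp0 (u s)])).trans (hmax s hs)
  have hporo : ∀ s ∈ Icc 0 T, √(Mp (u' s) (u' s)) ≤ m :=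
    fun s hs ↦ (Real.sqrt_le_sqrt (by
      linarith [hAp0 (u s), hAf0 (S s), hMf0 (S s), hDf0 (S s)])).trans (hmax s hs)
  have hS00 : ∀ B : Vf →L[ℝ] Vf →L[ℝ] ℝ, B (S 0) (S 0) = 0 := by simp [hS0]
  have h0 : (0:ℝ) ∈ Icc 0 T := left_mem_Icc.2 hT.le
  have hem : √(Mp (u' 0) (u' 0) + Ap (u 0) (u 0)) ≤ m := by
    simpa [hS0] using hmax 0 h0
  have he2 := Real.sq_sqrt (add_nonneg (hMp0 (u' 0)) (hAp0 (u 0)))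
  have hMD0 := add_nonneg (hMf0 (S t₁)) (hDf0 (S t₁))
  refine le_max_mul_of_energy_inequality (N := Mf (S t₁) (S t₁) + Df (S t₁) (S t₁))
    (P := Mp (u' t₁) (u' t₁) + Ap (u t₁) (u t₁) + Af (S t₁) (S t₁)) hT hm0
    (Real.sqrt_nonneg _) hem hMD0 ((hh0 t₁ ht₁).trans hsup) hJ0 (by rw [hm2]; ring)
    (by linarith [hMp0 (u' t₁), hAp0 (u t₁), hAf0 (S t₁)]) ?_
  have hHm : h t₁ * m ≤ sSup (h '' Icc 0 T) * m := by gcongr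
  rw [he2]
  rcases ht₁.1.eq_or_lt with ht0 | ht0
  · rw [← ht0] at hHm ⊢
    simp only [hS00]
    have := mul_nonneg hJ0 hm0
    have := mul_nonneg (hh0 0 h0) hm0
    simp only [add_zero, zero_div]
    linarith
  have hsub : Icc 0 t₁ ⊆ Icc 0 T := Icc_subset_Icc_right ht₁.2
  -- The modified energy is antitone on `[0, t₁]`; the terms linear in `S` and in time
  -- encode Jensen's inequality for `Mf + Df`.
  have hanti : AntitoneOn (fun s ↦ (Mp (u' s) (u' s) + Ap (u s) (u s) + Af (S s) (S s)) / 2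
      - Ff s (S s) + 2 * t₁⁻¹ * (Mf (S s) (S t₁) + Df (S s) (S t₁))
      - s * (t₁⁻¹ ^ 2 * (Mf (S t₁) (S t₁) + Df (S t₁) (S t₁)))
      - (∫ y in (0:ℝ)..s, (g y + h' y)) * m) (Icc 0 t₁) := by
    refine antitoneOn_of_hasDerivWithinAt_nonpos (convex_Icc 0 t₁)
      (f' := fun s ↦ (2 * Mp (u'' s) (u' s) + 2 * Ap (u' s) (u s) + 2 * Af (S' s) (S s)) / 2
        - (Ff' s (S s) + Ff s (S' s)) + 2 * t₁⁻¹ * (Mf (S' s) (S t₁) + Df (S' s) (S t₁))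
        - 1 * (t₁⁻¹ ^ 2 * (Mf (S t₁) (S t₁) + Df (S t₁) (S t₁)))
        - (g s + h' s) * m) ?_ ?_ ?_
    · have hprim : ContinuousOn (fun s ↦ ∫ y in (0:ℝ)..s, (g y + h' y)) (Icc 0 t₁) := by
        have := intervalIntegral.continuousOn_primitive_interval' hGi left_mem_uIcc
        rw [uIcc_of_le hT.le] at this
        exact this.mono hsub
      have huc := huc.mono hsub
      have huc' := huc'.mono hsub
      have hSc := hSc.mono hsub
      have hFfc := hFfc.mono hsub
      have hFS := hFfc.clm_apply hSc
      have hE : ContinuousOn (fun s ↦ Mp (u' s) (u' s) + Ap (u s) (u s) + Af (S s) (S s))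
          (Icc 0 t₁) := by fun_prop
      have hN : ContinuousOn (fun s ↦ 2 * t₁⁻¹ * (Mf (S s) (S t₁) + Df (S s) (S t₁)))
          (Icc 0 t₁) := by fun_prop
      exact ((((hE.div_const 2).sub hFS).add hN).sub
        (continuousOn_id.mul continuousOn_const)).sub (hprim.mul continuousOn_const)
    · intro s hs
      rw [interior_Icc] at hs
      have hsT : s ∈ Ioo 0 T := ⟨hs.1, hs.2.trans_le ht₁.2⟩
      have hnhds := Icc_mem_nhds hsT.1 hsT.2
      have hsI := Ioo_subset_Icc_self hsT
      have du := (hu s hsI).hasDerivAt hnhds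
      have du' := (hu' s hsI).hasDerivAt hnhds
      have dS := (hS s hsI).hasDerivAt hnhds
      have dF := (hFf s hsI).hasDerivAt hnhds
      have dlin (B : Vf →L[ℝ] Vf →L[ℝ] ℝ) :
          HasDerivAt (fun x ↦ B (S x) (S t₁)) (B (S' s) (S t₁)) s :=
        (B.flip (S t₁)).hasFDerivAt.comp_hasDerivAt s dS
      exact ((((((((hasDerivAt_symm_quadratic Mp hMp du').add
        (hasDerivAt_symm_quadratic Ap hAp du)).add
        (hasDerivAt_symm_quadratic Af hAf dS)).div_const 2).sub (dF.clm_apply dS)).add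
        (((dlin Mf).add (dlin Df)).const_mul _)).sub ((hasDerivAt_id s).mul_const _)).sub
        ((hasDerivAt_integral_of_continuousOn_Icc hGc hsT).mul_const m)).hasDerivWithinAt
    · intro s hs
      rw [interior_Icc] at hs
      have hsI : s ∈ Icc 0 T := hsub (Ioo_subset_Icc_self hs)
      have e := heq s hsI (u' s) (S' s) (r s)
      have i₁ := two_mul_apply_sub_sq_le Mf hMf hMf0 (S' s) (S t₁) t₁⁻¹
      have i₂ := two_mul_apply_sub_sq_le Df hDf hDf0 (S' s) (S t₁) t₁⁻¹
      have i₃ := (le_abs_self _).trans ((hFpb s hsI (u' s)).trans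
        (mul_le_mul_of_nonneg_left (hporo s hsI) (hg0 s hsI)))
      have i₄ := (neg_abs_le _).trans' (neg_le_neg ((hFfb' s hsI (S s)).trans
        (mul_le_mul_of_nonneg_left (hfluid s hsI) (hh0' s hsI))))
      rw [hAp (u s) (u' s), hAf (S s) (S' s)] at e
      linarith [hDp0 (u' s)]
  have hfin := hanti (left_mem_Icc.2 ht0.le) (right_mem_Icc.2 ht0.le) ht0.le
  simp only [intervalIntegral.integral_same, hS0, map_zero, zero_apply] at hfin
  have hFt := (le_abs_self _).trans ((hFfb t₁ ht₁ (S t₁)).trans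
    (mul_le_mul_of_nonneg_left (hfluid t₁ ht₁) (hh0 t₁ ht₁)))
  have hJmono : (∫ s in (0:ℝ)..t₁, (g s + h' s)) ≤ ∫ s in (0:ℝ)..T, (g s + h' s) := by
    refine intervalIntegral.integral_mono_interval le_rfl ht0.le ht₁.2 ?_ hGi
    refine (ae_restrict_iff' measurableSet_Ioc).2 (.of_forall fun s hs ↦ ?_)
    exact hJnn s (Ioc_subset_Icc_self hs)
  have hJm := mul_le_mul_of_nonneg_right hJmono hm0
  have hNT : (Mf (S t₁) (S t₁) + Df (S t₁) (S t₁)) / T ≤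
      (Mf (S t₁) (S t₁) + Df (S t₁) (S t₁)) / t₁ := by
    gcongr
    exact ht₁.2
  have hlin : 2 * t₁⁻¹ * (Mf (S t₁) (S t₁) + Df (S t₁) (S t₁)) -
      t₁ * (t₁⁻¹ ^ 2 * (Mf (S t₁) (S t₁) + Df (S t₁) (S t₁))) =
      (Mf (S t₁) (S t₁) + Df (S t₁) (S t₁)) / t₁ := by
    field_simp
    ring
  linarith
end

section
/- Under exactly the hypotheses of the abstract stability estimate for the coupled Stokes–Biot system — T > 0; real Banach spaces V_p, V_f, Λ; continuous symmetric positive-semidefinite bilinear forms M^p, A^p, D^p on V_p and M^f, D^f, A^f on V_f; continuous bilinear forms B^f : Λ × V_f → ℝ and C : V_p × V_f → ℝ; continuous nonnegative g, h, ĥ : [0,T] → ℝ; F_p : [0,T] → V_p' continuous with |F_p(t)(v)| ≤ g(t)·√(M^p(v,v)), and F_f : [0,T] → V_f' continuously differentiable with |F_f(t)(τ)| ≤ h(t)·√(A^f(τ,τ) + M^f(τ,τ) + D^f(τ,τ)) and |F_f'(t)(τ)| ≤ ĥ(t)·√(A^f(τ,τ) + M^f(τ,τ) + D^f(τ,τ))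 — let V_{p,h} ⊆ V_p, V_{f,h} ⊆ V_f, Λ_h ⊆ Λ be closed subspaces, and suppose u_h : [0,T] → V_{p,h} is twice continuously differentiable, Σ_h : [0,T] → V_{f,h} is continuously differentiable with Σ_h(0) = 0, r_h : [0,T] → Λ_h is continuous, and the variational equation M^p(u_h''(t), v) + M^f(Σ_h'(t), τ) + D^p(u_h'(t), v) + D^f(Σ_h'(t), τ) + A^p(u_h(t), v) + A^f(Σ_h(t), τ) + B^f(r_h(t), τ) - B^f(λ, Σ_h'(t)) + C(u_h'(t), τ) - C(v, Σ_h'(t)) = F_p(t)(v) + F_f(t)(τ) holds for all t ∈ [0,T] and all test functions (v, τ, λ) ∈ V_{p,h} × V_{f,h} × Λ_h only. Then the same stability bound holds with a constant K > 0 depending only on T (in particular independent of the subspaces): for all t ∈ [0,T], √(M^p(u_h'(t),u_h'(t)) + A^p(u_h(t),u_h(t)) + A^f(Σ_h(t),Σ_h(t)) + M^f(Σ_h(t),Σ_h(t)) + D^f(Σ_h(t),Σ_h(t))) ≤ K·( √(M^p(u_h'(0),u_h'(0)) + A^p(u_h(0),u_h(0))) + sup_{s∈[0,T]} h(s) + ∫₀ᵀ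 (g(s) + ĥ(s)) ds ). -/
open Set

/-- The derivative of a curve in a closed subspace lies in that subspace. -/
theorem Submodule.hasDerivWithinAt_mem {E : Type*} [NormedAddCommGroup E] [NormedSpace ℝ E]
    {W : Submodule ℝ E} (hW : IsClosed (W : Set E)) {s : Set ℝ} {f : ℝ → E} {f' : E} {t : ℝ}
    (hs : UniqueDiffOn ℝ s) (ht : t ∈ s) (hmem : ∀ x ∈ s, f x ∈ W)
    (hf : HasDerivWithinAt f f' s t) : f' ∈ W := by
  have h := range_derivWithin_subset_closure_span_image f (s := s) (t := s)
    (by rw [inter_self]; exact subset_closure) (mem_range_self t)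
  rw [hf.derivWithin (hs t ht)] at h
  refine closure_minimal ?_ hW h
  exact Submodule.span_le.2 (by rintro _ ⟨x, hx, rfl⟩; exact hmem x hx)

/-- The fundamental theorem of calculus for a continuous derivative on `[a, b]`. -/
theorem integral_eq_sub_of_hasDerivWithinAt_Icc {f f' : ℝ → ℝ} {a b : ℝ} (hab : a ≤ b)
    (hf : ∀ x ∈ Icc a b, HasDerivWithinAt f (f' x) (Icc a b) x)
    (hf' : ContinuousOn f' (Icc a b)) : ∫ x in a..b, f' x = f b - f a :=
  intervalIntegral.integral_eq_sub_of_hasDerivAt_of_le hab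
    (fun x hx => (hf x hx).continuousWithinAt)
    (fun x hx => (hf x (Ioo_subset_Icc_self hx)).hasDerivAt (Icc_mem_nhds hx.1 hx.2))
    (hf'.intervalIntegrable_of_Icc hab)

section BilinearForms

variable {E F : Type*} [NormedAddCommGroup E] [NormedSpace ℝ E]
  [NormedAddCommGroup F] [NormedSpace ℝ F]

theorem ContinuousLinearMap.continuousOn_apply₂ (B : E →L[ℝ] F →L[ℝ] ℝ) {s : Set ℝ}
    {f : ℝ → E} {g : ℝ → F} (hf : ContinuousOn f s) (hg : ContinuousOn g s) :
    ContinuousOn (fun t => B (f t) (g t)) s :=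
  (B.continuous.comp_continuousOn hf).clm_apply hg

theorem ContinuousLinearMap.hasDerivWithinAt_apply_self (B : E →L[ℝ] E →L[ℝ] ℝ)
    (hsymm : ∀ x y, B x y = B y x) {s : Set ℝ} {f : ℝ → E} {f' : E} {t : ℝ}
    (hf : HasDerivWithinAt f f' s t) :
    HasDerivWithinAt (fun t => B (f t) (f t)) (2 * B f' (f t)) s t := by
  have h := (B.hasFDerivAt.comp_hasDerivWithinAt t hf).clm_apply hf
  refine h.congr_deriv ?_
  simp only [Function.comp_apply, hsymm (f t) f']
  ring

/-- A Poincaré-type inequality: a curve starting at `0` is controlled by its derivative, in the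
seminorm of any positive semidefinite form. -/
theorem ContinuousLinearMap.apply_self_le_mul_integral (B : E →L[ℝ] E →L[ℝ] ℝ)
    (hsymm : ∀ x y, B x y = B y x) (hpsd : ∀ x, 0 ≤ B x x) {f f' : ℝ → E} {t : ℝ} (ht : 0 ≤ t)
    (hf : ∀ s ∈ Icc 0 t, HasDerivWithinAt f (f' s) (Icc 0 t) s)
    (hf' : ContinuousOn f' (Icc 0 t)) (h0 : f 0 = 0) :
    B (f t) (f t) ≤ t * ∫ s in (0:ℝ)..t, B (f' s) (f' s) := by
  rcases ht.eq_or_lt with rfl | htpos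
  · simp [h0]
  have hint : ∫ s in (0:ℝ)..t, B (f t) (f' s) = B (f t) (f t) := by
    rw [integral_eq_sub_of_hasDerivWithinAt_Icc ht
      (fun s hs => (B (f t)).hasFDerivAt.comp_hasDerivWithinAt s (hf s hs))
      ((B (f t)).continuous.comp_continuousOn hf')]
    simp [h0]
  have hcont := B.continuousOn_apply₂ hf' hf'
  have hpt : ∀ s, 2 * t * B (f t) (f' s) ≤ B (f t) (f t) + t ^ 2 * B (f' s) (f' s) := by
    intro s
    have h := hpsd (f t - t • f' s)
    simp only [map_sub, map_smul, sub_apply, smul_apply, smul_eq_mul,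
      hsymm (f' s) (f t)] at h
    linarith
  have hmono := intervalIntegral.integral_mono_on (μ := MeasureTheory.volume) ht
    ((((B (f t)).continuous.comp_continuousOn hf').const_mul (2 * t)).intervalIntegrable_of_Icc ht)
    (((hcont.const_mul (t ^ 2)).const_add (B (f t) (f t))).intervalIntegrable_of_Icc ht)
    (fun s _ => hpt s)
  rw [intervalIntegral.integral_add intervalIntegrable_const
    ((hcont.const_mul (t ^ 2)).intervalIntegrable_of_Icc ht)] at hmono
  simp only [Function.comp_apply, intervalIntegral.integral_const_mul,
    intervalIntegral.integral_const, hint, smul_eq_mul, sub_zero] at hmono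
  refine le_of_mul_le_mul_left ?_ htpos
  linarith

end BilinearForms

/-- If a continuous function `X` satisfies `X² ≤ c (a² + 2 b m)` for every upper bound
`m` of `X`, then `X` is bounded linearly in the data. -/
theorem le_of_sq_le_of_forall_upper_bound {T a b c : ℝ} (hT : 0 ≤ T) {X : ℝ → ℝ}
    (hX : ContinuousOn X (Icc 0 T)) (ha : 0 ≤ a) (hb : 0 ≤ b) (hc : 1 ≤ c)
    (h : ∀ m, (∀ t ∈ Icc 0 T, X t ≤ m) → ∀ t ∈ Icc 0 T, X t ^ 2 ≤ c * (a ^ 2 + 2 * b * m)) :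
    ∀ t ∈ Icc 0 T, X t ≤ 2 * c * (a + b) := by
  obtain ⟨x, hx, hmax⟩ := isCompact_Icc.exists_isMaxOn (nonempty_Icc.2 hT) hX
  have hle : ∀ t ∈ Icc 0 T, X t ≤ X x := fun t ht => hmax ht
  have hsq := h (X x) hle x hx
  intro t ht
  refine (hle t ht).trans ?_
  by_contra! hlt
  have ha' : a ≤ X x := by nlinarith
  have hpos : 0 < X x := (by positivity : 0 ≤ 2 * c * (a + b)).trans_lt hlt
  have h₁ : a ^ 2 + 2 * b * X x ≤ 2 * (a + b) * X x := by nlinarith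
  have h₂ := mul_le_mul_of_nonneg_left h₁ (zero_le_one.trans hc)
  nlinarith [mul_lt_mul_of_pos_right hlt hpos]

/-- Abstract semi-discrete stability estimate for the PolydG Galerkin discretization of
the coupled Stokes–Biot problem: a solution taking values in closed subspaces and
satisfying the variational formulation only against discrete test functions obeys the
same energy stability bound, with a constant depending only on `T` (in particular
independent of the subspaces). -/
theorem coupled_stokes_biot_semidiscrete_stability (T : ℝ) (hT : 0 < T) :
    ∃ K : ℝ, 0 < K ∧
      ∀ (Vp Vf Lam : Type*)
        [NormedAddCommGroup Vp] [NormedSpace ℝ Vp] [CompleteSpace Vp]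
        [NormedAddCommGroup Vf] [NormedSpace ℝ Vf] [CompleteSpace Vf]
        [NormedAddCommGroup Lam] [NormedSpace ℝ Lam] [CompleteSpace Lam]
        (Mp Ap Dp : Vp →L[ℝ] Vp →L[ℝ] ℝ)
        (_hMp_symm : ∀ x y : Vp, Mp x y = Mp y x) (_hMp_psd : ∀ x : Vp, 0 ≤ Mp x x)
        (_hAp_symm : ∀ x y : Vp, Ap x y = Ap y x) (_hAp_psd : ∀ x : Vp, 0 ≤ Ap x x)
        (_hDp_symm : ∀ x y : Vp, Dp x y = Dp y x) (_hDp_psd : ∀ x : Vp, 0 ≤ Dp x x)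
        (Mf Df Af : Vf →L[ℝ] Vf →L[ℝ] ℝ)
        (_hMf_symm : ∀ x y : Vf, Mf x y = Mf y x) (_hMf_psd : ∀ x : Vf, 0 ≤ Mf x x)
        (_hDf_symm : ∀ x y : Vf, Df x y = Df y x) (_hDf_psd : ∀ x : Vf, 0 ≤ Df x x)
        (_hAf_symm : ∀ x y : Vf, Af x y = Af y x) (_hAf_psd : ∀ x : Vf, 0 ≤ Af x x)
        (Bf : Lam →L[ℝ] Vf →L[ℝ] ℝ) (C : Vp →L[ℝ] Vf →L[ℝ] ℝ)
        (g h h' : ℝ → ℝ)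
        (_hg_cont : ContinuousOn g (Set.Icc 0 T)) (_hg_nonneg : ∀ t ∈ Set.Icc (0:ℝ) T, 0 ≤ g t)
        (_hh_cont : ContinuousOn h (Set.Icc 0 T)) (_hh_nonneg : ∀ t ∈ Set.Icc (0:ℝ) T, 0 ≤ h t)
        (_hh'_cont : ContinuousOn h' (Set.Icc 0 T))
        (_hh'_nonneg : ∀ t ∈ Set.Icc (0:ℝ) T, 0 ≤ h' t)
        (Fp : ℝ → Vp →L[ℝ] ℝ) (_hFp_cont : ContinuousOn Fp (Set.Icc 0 T))
        (_hFp_bound : ∀ t ∈ Set.Icc (0:ℝ) T, ∀ v : Vp,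
          |Fp t v| ≤ g t * Real.sqrt (Mp v v))
        (Ff Ff' : ℝ → Vf →L[ℝ] ℝ)
        (_hFf_deriv : ∀ t ∈ Set.Icc (0:ℝ) T, HasDerivWithinAt Ff (Ff' t) (Set.Icc 0 T) t)
        (_hFf'_cont : ContinuousOn Ff' (Set.Icc 0 T))
        (_hFf_bound : ∀ t ∈ Set.Icc (0:ℝ) T, ∀ τ : Vf,
          |Ff t τ| ≤ h t * Real.sqrt (Af τ τ + Mf τ τ + Df τ τ))
        (_hFf'_bound : ∀ t ∈ Set.Icc (0:ℝ) T, ∀ τ : Vf,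
          |Ff' t τ| ≤ h' t * Real.sqrt (Af τ τ + Mf τ τ + Df τ τ))
        (Vph : Submodule ℝ Vp) (_hVph : IsClosed (Vph : Set Vp))
        (Vfh : Submodule ℝ Vf) (_hVfh : IsClosed (Vfh : Set Vf))
        (Lamh : Submodule ℝ Lam) (_hLamh : IsClosed (Lamh : Set Lam))
        (u u' u'' : ℝ → Vp)
        (_hu_mem : ∀ t ∈ Set.Icc (0:ℝ) T, u t ∈ Vph)
        (_hu : ∀ t ∈ Set.Icc (0:ℝ) T, HasDerivWithinAt u (u' t) (Set.Icc 0 T) t)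
        (_hu' : ∀ t ∈ Set.Icc (0:ℝ) T, HasDerivWithinAt u' (u'' t) (Set.Icc 0 T) t)
        (_hu'' : ContinuousOn u'' (Set.Icc 0 T))
        (S S' : ℝ → Vf)
        (_hS_mem : ∀ t ∈ Set.Icc (0:ℝ) T, S t ∈ Vfh)
        (_hS : ∀ t ∈ Set.Icc (0:ℝ) T, HasDerivWithinAt S (S' t) (Set.Icc 0 T) t)
        (_hS' : ContinuousOn S' (Set.Icc 0 T))
        (_hS0 : S 0 = 0)
        (r : ℝ → Lam) (_hr_mem : ∀ t ∈ Set.Icc (0:ℝ) T, r t ∈ Lamh)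
        (_hr : ContinuousOn r (Set.Icc 0 T))
        (_heq : ∀ t ∈ Set.Icc (0:ℝ) T, ∀ v ∈ Vph, ∀ τ ∈ Vfh, ∀ l ∈ Lamh,
          Mp (u'' t) v + Mf (S' t) τ + Dp (u' t) v + Df (S' t) τ +
            Ap (u t) v + Af (S t) τ + Bf (r t) τ - Bf l (S' t) +
            C (u' t) τ - C v (S' t) = Fp t v + Ff t τ),
        ∀ t ∈ Set.Icc (0:ℝ) T,
          Real.sqrt (Mp (u' t) (u' t) + Ap (u t) (u t) + Af (S t) (S t) +
              Mf (S t) (S t) + Df (S t) (S t)) ≤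
            K * (Real.sqrt (Mp (u' 0) (u' 0) + Ap (u 0) (u 0)) +
              sSup (h '' Set.Icc 0 T) + ∫ s in (0:ℝ)..T, (g s + h' s)) := by
  refine ⟨2 + T, by linarith, ?_⟩
  intro Vp Vf Lam _ _ _ _ _ _ _ _ _ Mp Ap Dp hMp hMp0 hAp hAp0 _ hDp0 Mf Df Af hMf hMf0 hDf hDf0
    hAf hAf0 Bf C g h h' hg hg0 hh hh0 hh' hh0' Fp hFp hFpb Ff Ff' hFf hFf' hFfb hFfb'
    Vph hVph Vfh hVfh Lamh _ u u' u'' hum hu hu' hu'' S S' hSm hS hS' hS0 r hrm _ heq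
  have hud : UniqueDiffOn ℝ (Icc 0 T) := uniqueDiffOn_Icc hT
  have cu : ContinuousOn u (Icc 0 T) := fun x hx => (hu x hx).continuousWithinAt
  have cu' : ContinuousOn u' (Icc 0 T) := fun x hx => (hu' x hx).continuousWithinAt
  have cS : ContinuousOn S (Icc 0 T) := fun x hx => (hS x hx).continuousWithinAt
  have hQ : ∀ x y, (Mf + Df) x y = Mf x y + Df x y := fun x y => by simp
  set E : ℝ → ℝ := fun t => Mp (u' t) (u' t) + Ap (u t) (u t) + Af (S t) (S t) +
    Mf (S t) (S t) + Df (S t) (S t) with hE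
  have hE0 : ∀ t, 0 ≤ E t := fun t => by
    have := hMp0 (u' t); have := hAp0 (u t); have := hAf0 (S t)
    have := hMf0 (S t); have := hDf0 (S t)
    simp only [hE]; linarith
  have cE : ContinuousOn E (Icc 0 T) :=
    ((((Mp.continuousOn_apply₂ cu' cu').add (Ap.continuousOn_apply₂ cu cu)).add
      (Af.continuousOn_apply₂ cS cS)).add (Mf.continuousOn_apply₂ cS cS)).add
      (Df.continuousOn_apply₂ cS cS)
  have hMpE : ∀ t, √(Mp (u' t) (u' t)) ≤ √(E t) := fun t => Real.sqrt_le_sqrt (by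
    have := hAp0 (u t); have := hAf0 (S t); have := hMf0 (S t); have := hDf0 (S t)
    simp only [hE]; linarith)
  have hSE : ∀ t, √(Af (S t) (S t) + Mf (S t) (S t) + Df (S t) (S t)) ≤ √(E t) :=
    fun t => Real.sqrt_le_sqrt (by
      have := hMp0 (u' t); have := hAp0 (u t)
      simp only [hE]; linarith)
  have hbdd : BddAbove (h '' Icc 0 T) := (isCompact_Icc.image_of_continuousOn hh).bddAbove
  have hsup : ∀ t ∈ Icc 0 T, h t ≤ sSup (h '' Icc 0 T) := fun t ht =>
    le_csSup hbdd (mem_image_of_mem h ht)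
  have hsup0 : 0 ≤ sSup (h '' Icc 0 T) :=
    (hh0 0 ⟨le_rfl, hT.le⟩).trans (hsup 0 ⟨le_rfl, hT.le⟩)
  have cG : ContinuousOn (fun s => g s + h' s) (Icc 0 T) := hg.add hh'
  have hG0 : 0 ≤ ∫ s in (0:ℝ)..T, (g s + h' s) :=
    intervalIntegral.integral_nonneg hT.le fun s hs => add_nonneg (hg0 s hs) (hh0' s hs)
  have hinit : 0 ≤ Mp (u' 0) (u' 0) + Ap (u 0) (u 0) := add_nonneg (hMp0 _) (hAp0 _)
  have henergy : ∀ s ∈ Icc 0 T,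
      Mp (u'' s) (u' s) + Ap (u s) (u' s) + Af (S s) (S' s) + Dp (u' s) (u' s) +
        (Mf + Df) (S' s) (S' s) = Fp s (u' s) + Ff s (S' s) := by
    intro s hs
    have := heq s hs (u' s) (Submodule.hasDerivWithinAt_mem hVph hud hs hum (hu s hs))
      (S' s) (Submodule.hasDerivWithinAt_mem hVfh hud hs hSm (hS s hs)) (r s) (hrm s hs)
    rw [hQ]
    linarith
  have key := le_of_sq_le_of_forall_upper_bound (X := fun t => √(E t)) (c := 1 + T / 2) hT.le
    cE.sqrt (Real.sqrt_nonneg (Mp (u' 0) (u' 0) + Ap (u 0) (u 0)))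
    (add_nonneg hsup0 hG0) (by linarith) ?_
  · intro t ht
    have := key t ht
    linarith
  intro m hm t ht
  have hm0 : 0 ≤ m := (Real.sqrt_nonneg _).trans (hm t ht)
  rw [Real.sq_sqrt (hE0 t), Real.sq_sqrt hinit]
  have hsub : Icc 0 t ⊆ Icc 0 T := Icc_subset_Icc_right ht.2
  set Φ : ℝ → ℝ := fun s => Mp (u' s) (u' s) + Ap (u s) (u s) + Af (S s) (S s) - 2 * Ff s (S s)
    with hΦ
  have hΦ' : ∀ s ∈ Icc 0 t, HasDerivWithinAt Φ
      (2 * (Fp s (u' s) - Dp (u' s) (u' s) - (Mf + Df) (S' s) (S' s) - Ff' s (S s)))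
      (Icc 0 t) s := by
    intro s hs
    have hs' := hsub hs
    have hd := (((Mp.hasDerivWithinAt_apply_self hMp (hu' s hs')).add
      (Ap.hasDerivWithinAt_apply_self hAp (hu s hs'))).add
      (Af.hasDerivWithinAt_apply_self hAf (hS s hs'))).sub
      (((hFf s hs').clm_apply (hS s hs')).const_mul 2)
    refine (hd.congr_deriv ?_).mono hsub
    rw [hAp, hAf (S' s)]
    linarith [henergy s hs']
  have cQ := ((Mf + Df).continuousOn_apply₂ hS' hS').mono hsub
  have cD := (Dp.continuousOn_apply₂ cu' cu').mono hsub
  have cΦ' : ContinuousOn (fun s => 2 * (Fp s (u' s) - Dp (u' s) (u' s) -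
      (Mf + Df) (S' s) (S' s) - Ff' s (S s))) (Icc 0 t) :=
    (((((hFp.clm_apply cu').mono hsub).sub cD).sub cQ).sub
      ((hFf'.clm_apply cS).mono hsub)).const_mul 2
  have hftc := integral_eq_sub_of_hasDerivWithinAt_Icc ht.1 hΦ' cΦ'
  have cG' := (cG.mono hsub).const_mul (2 * m)
  have hmono := intervalIntegral.integral_mono_on (μ := MeasureTheory.volume) ht.1
    (cΦ'.intervalIntegrable_of_Icc ht.1)
    ((cG'.sub (cQ.const_mul 2)).intervalIntegrable_of_Icc ht.1) (by
      intro s hs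
      have hs' := hsub hs
      have h1 := (abs_le.1 (hFpb s hs' (u' s))).2
      have h2 := (abs_le.1 (hFfb' s hs' (S s))).1
      have h3 := mul_le_mul_of_nonneg_left ((hMpE s).trans (hm s hs')) (hg0 s hs')
      have h4 := mul_le_mul_of_nonneg_left ((hSE s).trans (hm s hs')) (hh0' s hs')
      have h5 := hDp0 (u' s)
      simp only [Pi.sub_apply]
      linarith)
  simp only [Pi.sub_apply] at hmono
  rw [hftc, intervalIntegral.integral_sub (cG'.intervalIntegrable_of_Icc ht.1)
    ((cQ.const_mul 2).intervalIntegrable_of_Icc ht.1),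
    intervalIntegral.integral_const_mul, intervalIntegral.integral_const_mul] at hmono
  have hGt : ∫ s in (0:ℝ)..t, (g s + h' s) ≤ ∫ s in (0:ℝ)..T, (g s + h' s) :=
    intervalIntegral.integral_mono_interval le_rfl ht.1 ht.2
      ((MeasureTheory.ae_restrict_iff' measurableSet_Ioc).2 (.of_forall fun s hs =>
        add_nonneg (hg0 s (Ioc_subset_Icc_self hs)) (hh0' s (Ioc_subset_Icc_self hs))))
      (cG.intervalIntegrable_of_Icc hT.le)
  have hGm := mul_le_mul_of_nonneg_left hGt hm0
  have hFt : Ff t (S t) ≤ sSup (h '' Icc 0 T) * m :=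
    ((abs_le.1 (hFfb t ht (S t))).2.trans
      (mul_le_mul_of_nonneg_left ((hSE t).trans (hm t ht)) (hh0 t ht))).trans
      (mul_le_mul_of_nonneg_right (hsup t ht) hm0)
  have hQ0 : ∀ x, 0 ≤ (Mf + Df) x x := fun x => by rw [hQ]; exact add_nonneg (hMf0 x) (hDf0 x)
  have hpoin := (Mf + Df).apply_self_le_mul_integral (fun x y => by rw [hQ, hQ, hMf, hDf])
    hQ0 ht.1 (fun s hs => (hS s (hsub hs)).mono hsub) (hS'.mono hsub) hS0
  have hD0 : 0 ≤ ∫ s in (0:ℝ)..t, (Mf + Df) (S' s) (S' s) :=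
    intervalIntegral.integral_nonneg ht.1 fun s _ => hQ0 _
  have hpoinT := hpoin.trans (mul_le_mul_of_nonneg_right ht.2 hD0)
  have hE1 : 0 ≤ Mp (u' t) (u' t) + Ap (u t) (u t) + Af (S t) (S t) :=
    add_nonneg (add_nonneg (hMp0 _) (hAp0 _)) (hAf0 _)
  rw [hQ (S t)] at hpoinT
  simp only [hΦ, hS0, map_zero] at hmono
  set D := ∫ s in (0:ℝ)..t, (Mf + Df) (S' s) (S' s)
  have hbase : Mp (u' t) (u' t) + Ap (u t) (u t) + Af (S t) (S t) + 2 * D ≤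
      Mp (u' 0) (u' 0) + Ap (u 0) (u 0) +
        2 * (sSup (h '' Icc 0 T) + ∫ s in (0:ℝ)..T, (g s + h' s)) * m := by
    linarith
  refine le_trans ?_ (mul_le_mul_of_nonneg_left hbase (by linarith : (0:ℝ) ≤ 1 + T / 2))
  have := mul_nonneg hT.le hE1
  simp only [hE]
  linarith
end
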